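/- arXiv:1309.3839 — 5 statements merged into one kernel-verified Lean document; each statement's English description precedes it below -/
import Mathlib

section
/- Let T : C_r(L₁) → C_r(L₂) be a map. Then T is a bi-orthogonality preserving real-linear surjection if and only if there exist: a homeomorphism φ : L₂ → L₁ with φ(O₂) = O₁; a function a₁ ∈ C_r(L₂) with a₁(s) ≠ 0 for all s ∈ L₂; and a function a₂ : L₂ → ℂ whose restriction to O₂ is continuous, such that, writing a₁ = γ₁ + iγ₂ and a₂ = η₁ + iη₂ in terms of real and imaginary parts, one has 0 < inf_{s ∈ O₂} |γ₁(s)η₂(s) − γ₂(s)η₁(s)| ≤ sup_{s ∈ O₂} |γ₁(s)η₂(s) − γ₂(s)η₁(s)| < +∞, and (Tf)(s) = a₁(s)·Re(f(φ(s))) + a₂(s)·Im(f(φ(s))) for every s ∈ L₂ and every f ∈ C_r(L₁). -/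
noncomputable section
set_option synthInstance.maxHeartbeats 1000000
set_option maxHeartbeats 1000000

/-- The real function algebra `C_r(L)` of continuous complex-valued functions on `L` that
take real values on the closed subset `F ⊆ L`, viewed as a real subalgebra of `C(L, ℂ)`
(with pointwise operations; the involution is pointwise conjugation and the norm is the sup
norm, both inherited from `C(L, ℂ)`). -/
def Cr (L : Type*) [TopologicalSpace L] (F : Set L) : Subalgebra ℝ C(L, ℂ) where
  carrier := {f : C(L, ℂ) | ∀ t ∈ F, (f t).im = 0}
  mul_mem' := by
    intro f g hf hg t ht
    simp [Complex.mul_im, hf t ht, hg t ht]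
  one_mem' := by intro t ht; simp
  add_mem' := by intro f g hf hg t ht; simp [hf t ht, hg t ht]
  zero_mem' := by intro t ht; simp
  algebraMap_mem' := by intro r t ht; simp

namespace Cr

open Set Filter Topology

section Basic

variable {L : Type*} [TopologicalSpace L] {F : Set L}

theorem mul_eq_zero_iff (f g : Cr L F) : f * g = 0 ↔ ∀ t, f.val t = 0 ∨ g.val t = 0 := by
  rw [Subtype.ext_iff, ContinuousMap.ext_iff]
  simp

theorem im_eq_zero (f : Cr L F) {t : L} (ht : t ∈ F) : (f.val t).im = 0 := f.2 t ht

/-- A real-valued continuous function, as an element of `Cr L F`. -/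
def ofRealMap (F : Set L) (u : C(L, ℝ)) : Cr L F :=
  ⟨⟨fun t => (u t : ℂ), by fun_prop⟩, fun t _ => by simp⟩

@[simp]
theorem ofRealMap_apply (u : C(L, ℝ)) (t : L) : (ofRealMap F u).val t = (u t : ℂ) := rfl

/-- The purely imaginary function `i u`, where `u` vanishes on `F`, as an element of `Cr L F`. -/
def imagMap (u : C(L, ℝ)) (hu : ∀ t ∈ F, u t = 0) : Cr L F :=
  ⟨⟨fun t => (u t : ℂ) * Complex.I, by fun_prop⟩, fun t ht => by simp [hu t ht]⟩

@[simp]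
theorem imagMap_apply (u : C(L, ℝ)) (hu : ∀ t ∈ F, u t = 0) (t : L) :
    (imagMap u hu).val t = (u t : ℂ) * Complex.I := rfl

theorem exists_bump [CompactSpace L] [T2Space L] {K : Set L} (hK : IsClosed K) {x : L}
    (hx : x ∉ K) :
    ∃ u : C(L, ℝ), u x = 1 ∧ (∀ t ∈ K, u t = 0) ∧ ∀ t, 0 ≤ u t ∧ u t ≤ 1 := by
  obtain ⟨u, h0, h1, h2⟩ := exists_continuous_zero_one_of_isClosed hK (isClosed_singleton (x := x))
    (by simpa using hx)
  exact ⟨u, h1 rfl, fun t ht => h0 ht, fun t => h2 t⟩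

end Basic

section Support

variable {L₁ L₂ : Type*} [TopologicalSpace L₁] [CompactSpace L₁] [T2Space L₁]
  [TopologicalSpace L₂] [CompactSpace L₂] [T2Space L₂] {F₁ : Set L₁} {F₂ : Set L₂}

/-- `t` is a support point of the functional `f ↦ T f s`. -/
def IsSupportPoint (T : Cr L₁ F₁ →ₗ[ℝ] Cr L₂ F₂) (s : L₂) (t : L₁) : Prop :=
  ∀ U : Set L₁, IsOpen U → t ∈ U → ∃ f : Cr L₁ F₁, (∀ x ∉ U, f.val x = 0) ∧ (T f).val s ≠ 0

omit [CompactSpace L₂] [T2Space L₂] in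
theorem exists_isSupportPoint (T : Cr L₁ F₁ →ₗ[ℝ] Cr L₂ F₂) {s : L₂}
    (hs : ∃ f, (T f).val s ≠ 0) : ∃ t, IsSupportPoint T s t := by
  by_contra! hcon
  simp only [IsSupportPoint, not_forall, not_exists, not_and, not_not] at hcon
  choose U hUo hUt hU using hcon
  obtain ⟨f, hf⟩ := hs
  obtain ⟨A, hA⟩ := isCompact_univ.elim_finite_subcover U hUo
    (fun t _ => mem_iUnion.2 ⟨t, hUt t⟩)
  obtain ⟨ρ, hρ, hρ1, -, -⟩ := exists_continuous_sum_one_of_isOpen_isCompact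
    (s := fun i : Fin A.card => U (A.equivFin.symm i).1) (fun i => hUo _) isCompact_univ
    (by
      intro x hx
      obtain ⟨i, hi, hx⟩ := mem_iUnion₂.1 (hA hx)
      exact mem_iUnion.2 ⟨A.equivFin ⟨i, hi⟩, by simpa using hx⟩)
  have hsum : f = ∑ i, ofRealMap F₁ (ρ i) * f := by
    apply Subtype.ext
    ext t
    have h1 := hρ1 (mem_univ t)
    simp only [Pi.one_apply, Finset.sum_apply] at h1
    have h2 : (∑ i, ((ρ i t : ℝ) : ℂ)) = 1 := by exact_mod_cast h1
    simp [ContinuousMap.sum_apply, ← Finset.sum_mul, h2]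
  apply hf
  rw [hsum, map_sum]
  have h0 : ∀ i, (T (ofRealMap F₁ (ρ i) * f)).val s = 0 := by
    intro i
    apply hU (A.equivFin.symm i).1
    intro x hx
    have : ρ i x = 0 := by
      by_contra h
      exact hx (hρ i (subset_tsupport _ h))
    simp [this]
  simp [ContinuousMap.sum_apply, h0]

omit [CompactSpace L₁] [T2Space L₁] [CompactSpace L₂] [T2Space L₂] in
theorem IsSupportPoint.apply_eq_zero {T : Cr L₁ F₁ →ₗ[ℝ] Cr L₂ F₂}
    (hT : ∀ f g, f * g = 0 → T f * T g = 0) {s : L₂} {t : L₁} (h : IsSupportPoint T s t)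
    {U : Set L₁} (hUo : IsOpen U) (htU : t ∈ U) {f : Cr L₁ F₁} (hf : ∀ x ∈ U, f.val x = 0) :
    (T f).val s = 0 := by
  obtain ⟨g, hg, hgs⟩ := h U hUo htU
  have hfg : f * g = 0 := by
    rw [mul_eq_zero_iff]
    intro x
    by_cases hx : x ∈ U
    · exact Or.inl (hf x hx)
    · exact Or.inr (hg x hx)
  exact ((mul_eq_zero_iff _ _).1 (hT f g hfg) s).resolve_right hgs

omit [CompactSpace L₂] [T2Space L₂] in
theorem continuous_of_isSupportPoint {T : Cr L₁ F₁ →ₗ[ℝ] Cr L₂ F₂}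
    (hT : ∀ f g, f * g = 0 → T f * T g = 0) {φ : L₂ → L₁} (h : ∀ s, IsSupportPoint T s (φ s)) :
    Continuous φ := by
  rw [continuous_iff_continuousAt]
  intro s₀ N hN
  obtain ⟨K, hK, hKc, hKN⟩ := exists_mem_nhds_isClosed_subset hN
  obtain ⟨g, hg, hgs⟩ := h s₀ (interior K) isOpen_interior (mem_interior_iff_mem_nhds.2 hK)
  have hev : ∀ᶠ s in 𝓝 s₀, (T g).val s ≠ 0 :=
    (T g).val.continuous.continuousAt.eventually_ne hgs
  refine hev.mono fun s hs => hKN ?_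
  by_contra hsK
  exact hs ((h s).apply_eq_zero hT hKc.isOpen_compl hsK
    fun x hx => hg x fun hx' => hx (interior_subset hx'))

omit [CompactSpace L₁] [T2Space L₁] in
theorem leftInverse_of_isSupportPoint (T : Cr L₁ F₁ ≃ₗ[ℝ] Cr L₂ F₂)
    (hT : ∀ f g, f * g = 0 ↔ T f * T g = 0) {φ : L₂ → L₁} {ψ : L₁ → L₂}
    (hφ : ∀ s, IsSupportPoint T.toLinearMap s (φ s))
    (hψ : ∀ t, IsSupportPoint T.symm.toLinearMap t (ψ t)) (s : L₂) : ψ (φ s) = s := by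
  have hT' : ∀ f g, f * g = 0 → T.symm.toLinearMap f * T.symm.toLinearMap g = 0 := by
    intro f g hfg
    refine (hT _ _).2 ?_
    rwa [LinearEquiv.coe_coe, LinearEquiv.apply_symm_apply, LinearEquiv.apply_symm_apply]
  by_contra hne
  obtain ⟨W', W, hW'o, hWo, hsW', hsW, hd⟩ := t2_separation hne
  have hψc : Continuous ψ := continuous_of_isSupportPoint hT' hψ
  obtain ⟨f, hf, hfs⟩ := hφ s (ψ ⁻¹' W') (hW'o.preimage hψc) hsW'
  obtain ⟨u, hus, hu, -⟩ := exists_bump hWo.isClosed_compl (x := s) (by simpa using hsW)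
  have hmul : f * T.symm (ofRealMap F₂ u) = 0 := by
    rw [mul_eq_zero_iff]
    intro t
    by_cases ht : ψ t ∈ W'
    · refine Or.inr ((hψ t).apply_eq_zero hT' hW'o ht fun x hx => ?_)
      simp [hu x (disjoint_left.1 hd hx)]
    · exact Or.inl (hf t ht)
  have := (mul_eq_zero_iff _ _).1 ((hT _ _).1 hmul) s
  rw [LinearEquiv.apply_symm_apply, ofRealMap_apply, hus, Complex.ofReal_one] at this
  exact hfs (this.resolve_right one_ne_zero)

/-- A real bump function which equals `1` near `1` and is supported in `[1/2, 3/2]`. -/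
def unitBump (x : ℝ) : ℝ := max 0 (min 1 (2 - 4 * |x - 1|))

theorem continuous_unitBump : Continuous unitBump := by
  unfold unitBump
  fun_prop

theorem unitBump_nonneg (x : ℝ) : 0 ≤ unitBump x := le_max_left _ _

theorem unitBump_le_one (x : ℝ) : unitBump x ≤ 1 := max_le zero_le_one (min_le_left _ _)

theorem unitBump_eq_one {x : ℝ} (h₁ : 3 / 4 < x) (h₂ : x < 5 / 4) : unitBump x = 1 := by
  have : |x - 1| ≤ 1 / 4 := abs_le.2 ⟨by linarith, by linarith⟩
  rw [unitBump, min_eq_left (by linarith), max_eq_right zero_le_one]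

theorem unitBump_eq_zero {x : ℝ} (h : x ≤ 1 / 2 ∨ 3 / 2 ≤ x) : unitBump x = 0 := by
  have : 1 / 2 ≤ |x - 1| := by
    rcases h with h | h
    · exact le_abs.2 (Or.inr (by linarith))
    · exact le_abs.2 (Or.inl (by linarith))
  exact max_eq_left ((min_le_right _ _).trans (by linarith))

theorem mul_unitBump_div_le {r x : ℝ} (hr : 0 < r) : x * unitBump (x / r) ≤ 2 * r := by
  by_cases h : 3 / 2 ≤ x / r
  · rw [unitBump_eq_zero (Or.inr h)]
    linarith
  · have hx : x < 3 / 2 * r := (div_lt_iff₀ hr).1 (not_le.1 h)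
    nlinarith [unitBump_nonneg (x / r), unitBump_le_one (x / r)]

theorem exists_frequently_scaled (f : Cr L₁ F₁) {t : ℕ → L₁} (ht0 : ∀ n, f.val (t n) ≠ 0)
    (ht1 : ‖f.val (t 0)‖ ≤ 1)
    (ht : ∀ n, ‖f.val (t (n + 1))‖ ≤ ‖f.val (t n)‖ / 4) :
    ∃ g : Cr L₁ F₁, ∀ n, ∃ U : Set L₁, IsOpen U ∧ t n ∈ U ∧
      ∀ x ∈ U, (g - (2 : ℝ) ^ n • f).val x = 0 := by
  set r : ℕ → ℝ := fun n => ‖f.val (t n)‖ with hr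
  have hr0 : ∀ n, 0 < r n := fun n => norm_pos_iff.2 (ht0 n)
  have hanti : Antitone r := antitone_nat_of_succ_le fun n => by
    have := ht n
    have := hr0 n
    simp only [hr] at *
    linarith
  have hlt : ∀ {m n}, m < n → r n ≤ r m / 4 := fun {m n} h => (hanti h).trans (ht m)
  have hr4 : ∀ n, r n ≤ (1 / 4) ^ n := by
    intro n
    induction n with
    | zero => simpa using ht1
    | succ k ih => rw [pow_succ]; linarith [hlt (Nat.lt_succ_self k)]
  let w : ℕ → C(L₁, ℝ) := fun n =>
    ⟨fun x => 2 ^ n * unitBump (‖f.val x‖ / r n), by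
      have := continuous_unitBump
      fun_prop⟩
  let G : ℕ → C(L₁, ℂ) := fun n => (ofRealMap F₁ (w n) * f).val
  have hGapp : ∀ n x, G n x = ((2 ^ n * unitBump (‖f.val x‖ / r n) : ℝ) : ℂ) * f.val x :=
    fun n x => rfl
  have hGn : ∀ n, ‖G n‖ ≤ 2 * (1 / 2) ^ n := by
    intro n
    rw [ContinuousMap.norm_le _ (by positivity)]
    intro x
    rw [hGapp, norm_mul, Complex.norm_real, Real.norm_of_nonneg
      (mul_nonneg (by positivity) (unitBump_nonneg _))]
    calc 2 ^ n * unitBump (‖f.val x‖ / r n) * ‖f.val x‖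
        = 2 ^ n * (‖f.val x‖ * unitBump (‖f.val x‖ / r n)) := by ring
      _ ≤ 2 ^ n * (2 * r n) :=
        mul_le_mul_of_nonneg_left (mul_unitBump_div_le (hr0 n)) (by positivity)
      _ ≤ 2 ^ n * (2 * (1 / 4) ^ n) := by gcongr; exact hr4 n
      _ = 2 * (2 * (1 / 4)) ^ n := by rw [mul_pow]; ring
      _ = 2 * (1 / 2) ^ n := by norm_num
  have hsum : Summable G := Summable.of_norm_bounded
    ((summable_geometric_of_lt_one (by norm_num) (by norm_num)).mul_left 2) hGn
  have happ : ∀ x, HasSum (fun n => G n x) ((∑' n, G n) x) := fun x =>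
    ContinuousMap.hasSum_apply hsum.hasSum x
  refine ⟨⟨∑' n, G n, fun x hx => ?_⟩, fun n => ?_⟩
  · have h1 := Complex.hasSum_im (happ x)
    have h2 : (fun n => (G n x).im) = fun _ => 0 := by
      funext n
      exact (ofRealMap F₁ (w n) * f).2 x hx
    rw [h2] at h1
    exact h1.unique hasSum_zero
  · refine ⟨{x | 3 / 4 < ‖f.val x‖ / r n ∧ ‖f.val x‖ / r n < 5 / 4}, ?_, ?_, ?_⟩
    · have hc : Continuous fun x => ‖f.val x‖ / r n := by fun_prop
      exact (isOpen_lt continuous_const hc).inter (isOpen_lt hc continuous_const)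
    · have : ‖f.val (t n)‖ / r n = 1 := div_self (hr0 n).ne'
      simp only [mem_ofPred_eq, this]
      norm_num
    · rintro x ⟨hx1, hx2⟩
      have hsingle : (∑' k, G k) x = G n x := by
        refine (happ x).unique (hasSum_single n fun m hm => ?_)
        rw [hGapp, unitBump_eq_zero]
        · simp
        · rw [lt_div_iff₀ (hr0 n)] at hx1
          rw [div_lt_iff₀ (hr0 n)] at hx2
          rcases lt_or_gt_of_ne hm with h | h
          · left
            rw [div_le_iff₀ (hr0 m)]
            linarith [hlt h, hr0 n]
          · right
            rw [le_div_iff₀ (hr0 m)]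
            linarith [hlt h, hr0 n]
      have hone := unitBump_eq_one hx1 hx2
      change (∑' k, G k) x - (2 : ℝ) ^ n • f.val x = 0
      rw [hsingle, hGapp, hone]
      simp

omit [T2Space L₂] in
theorem apply_eq_zero_of_isSupportPoint {T : Cr L₁ F₁ →ₗ[ℝ] Cr L₂ F₂}
    (hT : ∀ f g, f * g = 0 → T f * T g = 0) {φ : L₂ → L₁} (h : ∀ s, IsSupportPoint T s (φ s))
    {f : Cr L₁ F₁} {s₀ : L₂} (hf : f.val (φ s₀) = 0)
    (hopen : ∀ V ∈ 𝓝 s₀, φ '' V ∈ 𝓝 (φ s₀)) : (T f).val s₀ = 0 := by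
  by_contra hne
  have hφ := continuous_of_isSupportPoint hT h
  set δ := ‖(T f).val s₀‖ / 2 with hδ
  have hδ0 : 0 < δ := by positivity
  have hev : ∀ᶠ s in 𝓝 s₀, δ < ‖(T f).val s‖ :=
    (T f).val.continuous.norm.continuousAt.eventually (lt_mem_nhds (by linarith))
  have hstep : ∀ ε > 0, ∃ s, δ < ‖(T f).val s‖ ∧ f.val (φ s) ≠ 0 ∧ ‖f.val (φ s)‖ ≤ ε := by
    intro ε hε
    by_contra! hcon
    have hsmall : ∀ᶠ s in 𝓝 s₀, ‖f.val (φ s)‖ < ε := by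
      have : Continuous fun s => ‖f.val (φ s)‖ := by fun_prop
      exact this.continuousAt.eventually (gt_mem_nhds (by simpa [hf] using hε))
    have hnhds := hopen _ (hev.and hsmall)
    obtain ⟨U, hU, hUo, hsU⟩ := mem_nhds_iff.1 hnhds
    refine hne ((h s₀).apply_eq_zero hT hUo hsU fun x hx => ?_)
    obtain ⟨s, ⟨hs1, hs2⟩, rfl⟩ := hU hx
    by_contra h0
    exact absurd (hcon s hs1 h0) (not_lt.2 hs2.le)
  obtain ⟨σ, hσ0, hσ⟩ : ∃ σ : ℕ → {s // δ < ‖(T f).val s‖ ∧ f.val (φ s) ≠ 0},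
      ‖f.val (φ (σ 0))‖ ≤ 1 ∧
      ∀ n, ‖f.val (φ (σ (n + 1)))‖ ≤ ‖f.val (φ (σ n))‖ / 4 := by
    obtain ⟨s, h1, h2, h3⟩ := hstep 1 one_pos
    have hnext : ∀ p : {s // δ < ‖(T f).val s‖ ∧ f.val (φ s) ≠ 0},
        ∃ q : {s // δ < ‖(T f).val s‖ ∧ f.val (φ s) ≠ 0},
          ‖f.val (φ q)‖ ≤ ‖f.val (φ p)‖ / 4 := by
      intro p
      obtain ⟨s, h1, h2, h3⟩ := hstep (‖f.val (φ p)‖ / 4) (by have := p.2.2; positivity)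
      exact ⟨⟨s, h1, h2⟩, h3⟩
    choose next hnext using hnext
    exact ⟨fun n => Nat.rec ⟨s, h1, h2⟩ (fun _ p => next p) n, h3, fun n => hnext _⟩
  obtain ⟨g, hg⟩ := exists_frequently_scaled f (t := fun n => φ (σ n)) (fun n => (σ n).2.2) hσ0 hσ
  have hTg : ∀ n, 2 ^ n * δ ≤ ‖(T g).val‖ := by
    intro n
    obtain ⟨U, hUo, htU, hU⟩ := hg n
    have h0 := (h (σ n)).apply_eq_zero hT hUo htU hU
    have h1 : (T g).val (σ n) = (2 : ℝ) ^ n • (T f).val (σ n) := by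
      rw [map_sub, map_smul] at h0
      exact sub_eq_zero.1 h0
    calc 2 ^ n * δ ≤ 2 ^ n * ‖(T f).val (σ n)‖ := by gcongr; exact (σ n).2.1.le
      _ = ‖(T g).val (σ n)‖ := by rw [h1, norm_smul]; simp
      _ ≤ ‖(T g).val‖ := ContinuousMap.norm_coe_le_norm _ _
  obtain ⟨n, hn⟩ := pow_unbounded_of_one_lt (‖(T g).val‖ / δ) (one_lt_two (α := ℝ))
  rw [div_lt_iff₀ hδ0] at hn
  exact absurd (hTg n) (not_le.2 hn)

omit [CompactSpace L₁] [T2Space L₁] [CompactSpace L₂] [T2Space L₂] in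
theorem exists_nonvanishing (T : Cr L₁ F₁ ≃ₗ[ℝ] Cr L₂ F₂) (s : L₂) :
    ∃ f, (T.toLinearMap f).val s ≠ 0 :=
  ⟨T.symm 1, by rw [LinearEquiv.coe_coe, T.apply_symm_apply]; exact one_ne_zero⟩

/-- A bi-orthogonality preserving linear bijection induces a homeomorphism which carries
zeros to zeros. -/
theorem exists_homeomorph (T : Cr L₁ F₁ ≃ₗ[ℝ] Cr L₂ F₂)
    (hT : ∀ f g, f * g = 0 ↔ T f * T g = 0) :
    ∃ φ : L₂ ≃ₜ L₁, ∀ s f, f.val (φ s) = 0 ↔ (T f).val s = 0 := by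
  have hT₁ : ∀ f g, f * g = 0 → T.toLinearMap f * T.toLinearMap g = 0 := fun f g => (hT f g).1
  have hT₂ : ∀ f g, T.symm f * T.symm g = 0 ↔ f * g = 0 := fun f g => by
    rw [hT, T.apply_symm_apply, T.apply_symm_apply]
  have hT₃ : ∀ f g, f * g = 0 → T.symm.toLinearMap f * T.symm.toLinearMap g = 0 :=
    fun f g => (hT₂ f g).2
  choose φ hφ using fun s => exists_isSupportPoint T.toLinearMap (exists_nonvanishing T s)
  choose ψ hψ using fun t => exists_isSupportPoint T.symm.toLinearMap
    (exists_nonvanishing T.symm t)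
  let e : L₂ ≃ₜ L₁ :=
    { toFun := φ
      invFun := ψ
      left_inv := leftInverse_of_isSupportPoint T hT hφ hψ
      right_inv := leftInverse_of_isSupportPoint T.symm (fun f g => (hT₂ f g).symm) hψ
        (by rwa [LinearEquiv.symm_symm])
      continuous_toFun := continuous_of_isSupportPoint hT₁ hφ
      continuous_invFun := continuous_of_isSupportPoint hT₃ hψ }
  refine ⟨e, fun s f => ⟨fun hf => ?_, fun hf => ?_⟩⟩
  · exact apply_eq_zero_of_isSupportPoint hT₁ hφ hf fun V hV => e.isOpenMap.image_mem_nhds hV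
  · have := apply_eq_zero_of_isSupportPoint hT₃ hψ (f := T f) (s₀ := e s)
      (by rw [show ψ (e s) = s from e.symm_apply_apply s]; exact hf)
      fun V hV => e.symm.isOpenMap.image_mem_nhds hV
    rwa [LinearEquiv.coe_coe, T.symm_apply_apply] at this

end Support

theorem mem_of_apply_mem {L₁ L₂ : Type*} [TopologicalSpace L₁] [CompactSpace L₁]
    [TopologicalSpace L₂] [CompactSpace L₂] [T2Space L₂] {F₁ : Set L₁} {F₂ : Set L₂}
    (hF₂ : IsClosed F₂) (T : Cr L₁ F₁ →ₗ[ℝ] Cr L₂ F₂) (hsurj : Function.Surjective T)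
    (φ : L₂ → L₁) (hT : ∀ s f, f.val (φ s) = 0 → (T f).val s = 0) {s : L₂} (hs : φ s ∈ F₁) :
    s ∈ F₂ := by
  by_contra hs₂
  have hreal : ∀ h : Cr L₂ F₂, ∃ c : ℝ, h.val s = c • (T 1).val s := by
    intro h
    obtain ⟨f, rfl⟩ := hsurj h
    have h0 : (f - (f.val (φ s)).re • (1 : Cr L₁ F₁)).val (φ s) = 0 := by
      change f.val (φ s) - (f.val (φ s)).re • (1 : ℂ) = 0
      apply Complex.ext <;> simp [im_eq_zero f hs]
    have h1 := hT _ _ h0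
    rw [map_sub, map_smul] at h1
    exact ⟨_, sub_eq_zero.1 h1⟩
  obtain ⟨u, hu1, hu0, -⟩ := exists_bump hF₂ hs₂
  obtain ⟨c, hc⟩ := hreal 1
  obtain ⟨d, hd⟩ := hreal (imagMap u hu0)
  change (1 : ℂ) = _ at hc
  rw [imagMap_apply, hu1] at hd
  have c1 := congrArg Complex.re hc
  have c2 := congrArg Complex.im hc
  have d2 := congrArg Complex.im hd
  simp only [Complex.smul_re, Complex.smul_im, smul_eq_mul, Complex.one_re, Complex.one_im,
    Complex.ofReal_one, one_mul, Complex.I_im] at c1 c2 d2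
  rcases mul_eq_zero.1 c2.symm with h | h
  · simp [h] at c1
  · simp [h] at d2

section Representation

variable {L₁ L₂ : Type*} [TopologicalSpace L₁] [CompactSpace L₁] [T2Space L₁]
  [TopologicalSpace L₂] [CompactSpace L₂] {F₁ : Set L₁} {F₂ : Set L₂}

theorem abs_det_le (z w : ℂ) : |z.re * w.im - z.im * w.re| ≤ ‖z‖ * ‖w‖ := by
  have h := Complex.abs_im_le_norm ((starRingEnd ℂ) z * w)
  rw [norm_mul, Complex.norm_conj, Complex.mul_im, Complex.conj_re, Complex.conj_im] at h
  rwa [neg_mul, ← sub_eq_add_neg] at h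

theorem exists_norm_coeff_le (hF₁ : IsClosed F₁) (T : Cr L₁ F₁ → Cr L₂ F₂) (φ : L₂ → L₁)
    (hφ : ∀ s, φ s ∈ F₁ → s ∈ F₂) (a₁ a₂ : L₂ → ℂ)
    (hT : ∀ s f, (T f).val s = a₁ s * ((f.val (φ s)).re : ℂ) + a₂ s * ((f.val (φ s)).im : ℂ)) :
    ∃ M, ∀ s ∉ F₂, ‖a₂ s‖ ≤ M := by
  by_contra! hcon
  choose s hs hlarge using fun n : ℕ => hcon (4 ^ n)
  choose u hu1 hu0 hu using fun n : ℕ => exists_bump hF₁ (x := φ (s n)) fun h => hs n (hφ _ h)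
  have hle : ∀ n, ‖(1 / 2 : ℝ) ^ n • u n‖ ≤ (1 / 2) ^ n := by
    intro n
    rw [ContinuousMap.norm_le _ (by positivity)]
    intro x
    rw [ContinuousMap.smul_apply, smul_eq_mul,
      Real.norm_of_nonneg (mul_nonneg (by positivity) (hu n x).1)]
    exact mul_le_of_le_one_right (by positivity) (hu n x).2
  have hsum : Summable fun n => (1 / 2 : ℝ) ^ n • u n :=
    Summable.of_norm_bounded (summable_geometric_of_lt_one (by norm_num) (by norm_num)) hle
  set v := ∑' n, (1 / 2 : ℝ) ^ n • u n with hv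
  have happ : ∀ x, HasSum (fun n => (1 / 2 : ℝ) ^ n * u n x) (v x) := fun x =>
    ContinuousMap.hasSum_apply hsum.hasSum x
  have hv0 : ∀ t ∈ F₁, v t = 0 := by
    intro t ht
    have := happ t
    simp only [hu0 _ t ht, mul_zero] at this
    exact this.unique hasSum_zero
  have hv1 : ∀ n, (1 / 2) ^ n ≤ v (φ (s n)) := by
    intro n
    have := le_hasSum (happ (φ (s n))) n
      fun m _ => mul_nonneg (by positivity) (hu m _).1
    simpa [hu1] using this
  have hbig : ∀ n, (2 : ℝ) ^ n ≤ ‖(T (imagMap v hv0)).val‖ := by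
    intro n
    have h1 : (T (imagMap v hv0)).val (s n) = a₂ (s n) * (v (φ (s n)) : ℂ) := by
      rw [hT]
      simp
    have hpos : 0 ≤ v (φ (s n)) := le_trans (by positivity) (hv1 n)
    calc (2 : ℝ) ^ n = 4 ^ n * (1 / 2) ^ n := by rw [← mul_pow]; norm_num
      _ ≤ ‖a₂ (s n)‖ * v (φ (s n)) := by
        have := (hlarge n).le
        have := hv1 n
        gcongr
      _ = ‖(T (imagMap v hv0)).val (s n)‖ := by
        rw [h1, norm_mul, Complex.norm_real, Real.norm_of_nonneg hpos]
      _ ≤ _ := ContinuousMap.norm_coe_le_norm _ _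
  obtain ⟨n, hn⟩ := pow_unbounded_of_one_lt ‖(T (imagMap v hv0)).val‖ (one_lt_two (α := ℝ))
  exact absurd (hbig n) (not_le.2 hn)

omit [CompactSpace L₂] in
theorem exists_coeff (hF₁ : IsClosed F₁) (T : Cr L₁ F₁ →ₗ[ℝ] Cr L₂ F₂)
    (φ : C(L₂, L₁)) (hφ : ∀ s, φ s ∈ F₁ → s ∈ F₂) (hφ' : ∀ s ∈ F₂, φ s ∈ F₁)
    (hT : ∀ s f, f.val (φ s) = 0 → (T f).val s = 0) :
    ∃ a₂ : L₂ → ℂ, ContinuousOn a₂ F₂ᶜ ∧ ∀ s f, (T f).val s =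
      (T 1).val s * ((f.val (φ s)).re : ℂ) + a₂ s * ((f.val (φ s)).im : ℂ) := by
  have hex : ∀ s, ∃ z : ℂ, ∀ f, (T f).val s =
      (T 1).val s * ((f.val (φ s)).re : ℂ) + z * ((f.val (φ s)).im : ℂ) := by
    intro s
    by_cases hs : s ∈ F₂
    · refine ⟨0, fun f => ?_⟩
      have him := im_eq_zero f (hφ' s hs)
      have h0 : (f - (f.val (φ s)).re • (1 : Cr L₁ F₁)).val (φ s) = 0 := by
        change f.val (φ s) - (f.val (φ s)).re • (1 : ℂ) = 0
        apply Complex.ext <;> simp [him]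
      have h1 := hT _ _ h0
      rw [map_sub, map_smul] at h1
      change (T f).val s - (f.val (φ s)).re • (T 1).val s = 0 at h1
      rw [sub_eq_zero.1 h1, Complex.real_smul]
      ring
    · obtain ⟨u, hu1, hu0, -⟩ := exists_bump hF₁ (x := φ s) fun h => hs (hφ s h)
      refine ⟨(T (imagMap u hu0)).val s, fun f => ?_⟩
      have h0 : (f - (f.val (φ s)).re • (1 : Cr L₁ F₁)
          - (f.val (φ s)).im • imagMap u hu0).val (φ s) = 0 := by
        change f.val (φ s) - (f.val (φ s)).re • (1 : ℂ)
          - (f.val (φ s)).im • ((u (φ s) : ℂ) * Complex.I) = 0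
        apply Complex.ext <;> simp [hu1]
      have h1 := hT _ _ h0
      rw [map_sub, map_sub, map_smul, map_smul] at h1
      change (T f).val s - (f.val (φ s)).re • (T 1).val s
        - (f.val (φ s)).im • (T (imagMap u hu0)).val s = 0 at h1
      rw [sub_sub] at h1
      rw [sub_eq_zero.1 h1, Complex.real_smul, Complex.real_smul]
      ring
  choose a₂ ha₂ using hex
  refine ⟨a₂, fun s₀ hs₀ => ContinuousAt.continuousWithinAt ?_, ha₂⟩
  obtain ⟨u, hu1, hu0, -⟩ := exists_bump hF₁ (x := φ s₀) fun h => hs₀ (hφ s₀ h)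
  have hu : Continuous fun s => (u (φ s) : ℂ) := by fun_prop
  have hne : (u (φ s₀) : ℂ) ≠ 0 := by simp [hu1]
  have hquot : ContinuousAt (fun s => (T (imagMap u hu0)).val s / (u (φ s) : ℂ)) s₀ :=
    (T (imagMap u hu0)).val.continuous.continuousAt.div hu.continuousAt hne
  refine hquot.congr ?_
  filter_upwards [hu.continuousAt.eventually_ne hne] with s hs
  rw [ha₂]
  simp [hs]

theorem norm_le_of_det {a b : ℂ} {m M x y : ℝ} (hm : 0 < m) (ha : ‖a‖ ≤ M) (hb : ‖b‖ ≤ M)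
    (hdet : m ≤ |a.re * b.im - a.im * b.re|) :
    ‖(⟨x, y⟩ : ℂ)‖ ≤ 2 * M / m * ‖a * (x : ℂ) + b * (y : ℂ)‖ := by
  set w := a * (x : ℂ) + b * (y : ℂ) with hw
  have hx : |a.re * b.im - a.im * b.re| * |x| ≤ ‖w‖ * M := by
    rw [← abs_mul]
    calc _ = |w.re * b.im - w.im * b.re| := by congr 1; simp [hw]; ring
      _ ≤ ‖w‖ * ‖b‖ := abs_det_le _ _
      _ ≤ _ := by gcongr
  have hy : |a.re * b.im - a.im * b.re| * |y| ≤ M * ‖w‖ := by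
    rw [← abs_mul]
    calc _ = |a.re * w.im - a.im * w.re| := by congr 1; simp [hw]; ring
      _ ≤ ‖a‖ * ‖w‖ := abs_det_le _ _
      _ ≤ _ := by gcongr
  have hz : ‖(⟨x, y⟩ : ℂ)‖ ≤ |x| + |y| := Complex.norm_le_abs_re_add_abs_im _
  rw [div_mul_eq_mul_div, le_div_iff₀ hm]
  have h1 : |x| * m ≤ |x| * |a.re * b.im - a.im * b.re| := by gcongr
  have h2 : |y| * m ≤ |y| * |a.re * b.im - a.im * b.re| := by gcongr
  nlinarith

theorem surjective_of_repr (hF₁ : IsClosed F₁) (hF₂ : IsClosed F₂) (T : Cr L₁ F₁ → Cr L₂ F₂)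
    (φ : L₂ ≃ₜ L₁) (hφ : ∀ s, φ s ∈ F₁ ↔ s ∈ F₂) (a₁ : Cr L₂ F₂) (a₂ : L₂ → ℂ)
    (ha₁ : ∀ s, a₁.val s ≠ 0) (ha₂ : ContinuousOn a₂ F₂ᶜ) {m : ℝ} (hm : 0 < m)
    (hdet : ∀ s ∈ F₂ᶜ, m ≤ |(a₁.val s).re * (a₂ s).im - (a₁.val s).im * (a₂ s).re|)
    (hT : ∀ s f, (T f).val s =
      a₁.val s * ((f.val (φ s)).re : ℂ) + a₂ s * ((f.val (φ s)).im : ℂ)) :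
    Function.Surjective T := by
  obtain ⟨M₂, hM₂⟩ := exists_norm_coeff_le hF₁ T φ (fun s => (hφ s).1) _ a₂ hT
  obtain ⟨c, hc, hca⟩ := isCompact_univ.exists_forall_le' (f := fun s => ‖a₁.val s‖) (a := 0)
    (by fun_prop) fun s _ => norm_pos_iff.2 (ha₁ s)
  obtain ⟨C, hC⟩ : ∃ C : ℝ, ∀ (s : L₂) (x y : ℝ), (s ∈ F₂ → y = 0) →
      ‖(⟨x, y⟩ : ℂ)‖ ≤ C * ‖a₁.val s * (x : ℂ) + a₂ s * (y : ℂ)‖ := by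
    refine ⟨max (2 * max ‖a₁.val‖ M₂ / m) (1 / c), fun s x y hs => ?_⟩
    by_cases hsF : s ∈ F₂
    · have hnorm : ‖(⟨x, y⟩ : ℂ)‖ = |x| := by
        rw [hs hsF]
        exact Complex.norm_real x
      calc ‖(⟨x, y⟩ : ℂ)‖ = |x| := hnorm
        _ ≤ 1 / c * (‖a₁.val s‖ * |x|) := by
          rw [one_div, ← mul_assoc]
          refine le_mul_of_one_le_left (abs_nonneg x) ?_
          rw [← div_eq_inv_mul, le_div_iff₀ hc, one_mul]
          exact hca s (mem_univ s)
        _ = 1 / c * ‖a₁.val s * (x : ℂ) + a₂ s * (y : ℂ)‖ := by simp [hs hsF]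
        _ ≤ _ := by gcongr; exact le_max_right _ _
    · refine (norm_le_of_det (M := max ‖a₁.val‖ M₂) hm
        ((ContinuousMap.norm_coe_le_norm _ _).trans (le_max_left _ _))
        ((hM₂ s hsF).trans (le_max_right _ _)) (hdet s hsF)).trans ?_
      gcongr
      exact le_max_left _ _
  intro h
  have hsolve : ∀ s, ∃ z : ℂ, (s ∈ F₂ → z.im = 0) ∧
      a₁.val s * (z.re : ℂ) + a₂ s * (z.im : ℂ) = h.val s := by
    intro s
    by_cases hs : s ∈ F₂
    · refine ⟨h.val s / a₁.val s, fun _ => ?_, ?_⟩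
      · simp [Complex.div_im, im_eq_zero _ hs]
      · have him : (h.val s / a₁.val s).im = 0 := by simp [Complex.div_im, im_eq_zero _ hs]
        have hre : ((h.val s / a₁.val s).re : ℂ) = h.val s / a₁.val s :=
          Complex.ext (by simp) (by simp [him])
        rw [hre, him]
        field_simp [ha₁ s]
        simp
    · set D := (a₁.val s).re * (a₂ s).im - (a₁.val s).im * (a₂ s).re with hD
      have hD0 : D ≠ 0 := abs_pos.1 (hm.trans_le (hdet s hs))
      refine ⟨⟨((h.val s).re * (a₂ s).im - (h.val s).im * (a₂ s).re) / D,
        ((a₁.val s).re * (h.val s).im - (a₁.val s).im * (h.val s).re) / D⟩,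
        fun h => absurd h hs, ?_⟩
      apply Complex.ext
      · simp only [Complex.add_re, Complex.mul_re, Complex.ofReal_re, Complex.ofReal_im]
        field_simp
        rw [hD]
        ring
      · simp only [Complex.add_im, Complex.mul_im, Complex.ofReal_re, Complex.ofReal_im]
        field_simp
        rw [hD]
        ring
  choose k hk0 hk using hsolve
  have hkc : Continuous k := by
    rw [continuous_iff_continuousAt]
    intro s₀
    set R : L₂ → ℂ := fun s =>
      h.val s - (a₁.val s * ((k s₀).re : ℂ) + a₂ s * ((k s₀).im : ℂ)) with hR
    have hR0 : R s₀ = 0 := by simp [hR, hk]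
    have hRc : ContinuousAt R s₀ := by
      by_cases hs₀ : s₀ ∈ F₂
      · have : R = fun s => h.val s - a₁.val s * ((k s₀).re : ℂ) := by
          funext s
          simp [hR, hk0 s₀ hs₀]
        rw [this]
        fun_prop
      · have := ha₂.continuousAt (hF₂.isOpen_compl.mem_nhds hs₀)
        have := h.val.continuous
        have := a₁.val.continuous
        fun_prop
    have hev : ∀ᶠ s in 𝓝 s₀, s ∈ F₂ → (k s₀).im = 0 := by
      by_cases hs₀ : s₀ ∈ F₂
      · exact Eventually.of_forall fun s _ => hk0 s₀ hs₀
      · filter_upwards [hF₂.isOpen_compl.mem_nhds hs₀] with s hs hs'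
        exact absurd hs' hs
    have hlim : Tendsto (fun s => C * ‖R s‖) (𝓝 s₀) (𝓝 0) := by
      have := (hRc.norm.tendsto).const_mul C
      simpa [hR0] using this
    rw [ContinuousAt, tendsto_iff_norm_sub_tendsto_zero]
    refine squeeze_zero' (Eventually.of_forall fun _ => norm_nonneg _) ?_ hlim
    filter_upwards [hev] with s hs
    have hCs := hC s (k s - k s₀).re (k s - k s₀).im fun hsF => by simp [hk0 s hsF, hs hsF]
    refine hCs.trans_eq ?_
    congr 2
    rw [hR]
    simp only [← hk s, Complex.sub_re, Complex.sub_im, Complex.ofReal_sub]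
    ring
  refine ⟨⟨⟨fun t => k (φ.symm t), by fun_prop⟩, fun t ht => hk0 _ ?_⟩, ?_⟩
  · rwa [← hφ, φ.apply_symm_apply]
  · apply Subtype.ext
    ext s
    rw [hT]
    simpa using hk s

omit [CompactSpace L₁] [T2Space L₁] [CompactSpace L₂] in
theorem mul_eq_zero_iff_of_repr (T : Cr L₁ F₁ → Cr L₂ F₂)
    (φ : L₂ ≃ₜ L₁) (hφ : ∀ s, φ s ∈ F₁ ↔ s ∈ F₂) (a₁ : Cr L₂ F₂) (a₂ : L₂ → ℂ)
    (ha₁ : ∀ s, a₁.val s ≠ 0)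
    (hdet : ∀ s ∈ F₂ᶜ, (a₁.val s).re * (a₂ s).im - (a₁.val s).im * (a₂ s).re ≠ 0)
    (hT : ∀ s f, (T f).val s =
      a₁.val s * ((f.val (φ s)).re : ℂ) + a₂ s * ((f.val (φ s)).im : ℂ)) (f g : Cr L₁ F₁) :
    f * g = 0 ↔ T f * T g = 0 := by
  have hz : ∀ f s, f.val (φ s) = 0 ↔ (T f).val s = 0 := by
    intro f s
    refine ⟨fun h => by simp [hT, h], fun h => ?_⟩
    rw [hT] at h
    by_cases hs : s ∈ F₂
    · have him := im_eq_zero f ((hφ s).2 hs)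
      rw [him] at h
      have hre : (f.val (φ s)).re = 0 := by simpa [ha₁ s] using h
      exact Complex.ext hre him
    · have hpos := abs_pos.2 (hdet s hs)
      have := norm_le_of_det (x := (f.val (φ s)).re) (y := (f.val (φ s)).im) hpos
        (le_max_left ‖a₁.val s‖ ‖a₂ s‖) (le_max_right _ _) le_rfl
      rw [h, norm_zero, mul_zero] at this
      exact norm_le_zero_iff.1 this
  rw [mul_eq_zero_iff, mul_eq_zero_iff]
  simp only [← hz]
  exact φ.surjective.forall

end Representation

theorem exists_repr_of_mul_eq_zero_iff {L₁ L₂ : Type*}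
    [TopologicalSpace L₁] [CompactSpace L₁] [T2Space L₁]
    [TopologicalSpace L₂] [CompactSpace L₂] [T2Space L₂]
    {F₁ : Set L₁} {F₂ : Set L₂} (hF₁ : IsClosed F₁) (hF₂ : IsClosed F₂)
    (T : Cr L₁ F₁ ≃ₗ[ℝ] Cr L₂ F₂) (hT : ∀ f g, f * g = 0 ↔ T f * T g = 0) :
    ∃ (φ : L₂ ≃ₜ L₁) (a₁ : Cr L₂ F₂) (a₂ : L₂ → ℂ), (∀ s, φ s ∈ F₁ ↔ s ∈ F₂) ∧
      (∀ s, a₁.val s ≠ 0) ∧ ContinuousOn a₂ F₂ᶜ ∧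
      (∃ m M : ℝ, 0 < m ∧ ∀ s ∈ F₂ᶜ,
        m ≤ |(a₁.val s).re * (a₂ s).im - (a₁.val s).im * (a₂ s).re| ∧
        |(a₁.val s).re * (a₂ s).im - (a₁.val s).im * (a₂ s).re| ≤ M) ∧
      ∀ s f, (T f).val s =
        a₁.val s * ((f.val (φ s)).re : ℂ) + a₂ s * ((f.val (φ s)).im : ℂ) := by
  obtain ⟨φ, hφ⟩ := exists_homeomorph T hT
  have hφs : ∀ t h, h.val (φ.symm t) = 0 → (T.symm h).val t = 0 := by
    intro t h hh
    have := (hφ (φ.symm t) (T.symm h)).2 (by rwa [T.apply_symm_apply])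
    rwa [φ.apply_symm_apply] at this
  have hF : ∀ s, φ s ∈ F₁ → s ∈ F₂ := fun s =>
    mem_of_apply_mem hF₂ T.toLinearMap T.surjective φ fun s f => (hφ s f).1
  have hFs : ∀ t, φ.symm t ∈ F₂ → t ∈ F₁ := fun t =>
    mem_of_apply_mem hF₁ T.symm.toLinearMap T.symm.surjective φ.symm hφs
  have hF' : ∀ s ∈ F₂, φ s ∈ F₁ := fun s hs => hFs _ (by rwa [φ.symm_apply_apply])
  have hFs' : ∀ t ∈ F₁, φ.symm t ∈ F₂ := fun t ht => hF _ (by rwa [φ.apply_symm_apply])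
  obtain ⟨a₂, ha₂, hrep⟩ := exists_coeff hF₁ T.toLinearMap (φ : C(L₂, L₁)) hF hF'
    fun s f => (hφ s f).1
  obtain ⟨b₂, -, hreps⟩ := exists_coeff hF₂ T.symm.toLinearMap (φ.symm : C(L₁, L₂)) hFs hFs'
    hφs
  replace hrep : ∀ s f, (T f).val s =
    (T 1).val s * ((f.val (φ s)).re : ℂ) + a₂ s * ((f.val (φ s)).im : ℂ) := hrep
  replace hreps : ∀ t h, (T.symm h).val t = (T.symm 1).val t * ((h.val (φ.symm t)).re : ℂ)
    + b₂ t * ((h.val (φ.symm t)).im : ℂ) := hreps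
  obtain ⟨M, hM⟩ := exists_norm_coeff_le hF₁ T φ hF _ a₂ hrep
  obtain ⟨N, hN⟩ := exists_norm_coeff_le hF₂ T.symm φ.symm hFs _ b₂ hreps
  refine ⟨φ, T 1, a₂, fun s => ⟨hF s, hF' s⟩, fun s h => ?_, ha₂,
    ⟨1 / (‖(T.symm 1).val‖ * |N| + 1), ‖(T 1).val‖ * M, by positivity, fun s hs => ⟨?_, ?_⟩⟩, hrep⟩
  · exact one_ne_zero ((hφ s 1).2 h)
  · obtain ⟨v, hv1, hv0, -⟩ := exists_bump hF₂ hs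
    have e1 := hrep s (T.symm 1)
    have e2 := hrep s (T.symm (imagMap v hv0))
    rw [T.apply_symm_apply] at e1 e2
    rw [hreps (φ s) (imagMap v hv0), φ.symm_apply_apply, imagMap_apply, hv1] at e2
    change (1 : ℂ) = _ at e1
    set p := (T.symm 1).val (φ s)
    set q := b₂ (φ s)
    set a := (T 1).val s
    set b := a₂ s
    have hE : |p.re * q.im - p.im * q.re| ≤ ‖(T.symm 1).val‖ * |N| := by
      refine (abs_det_le p q).trans ?_
      gcongr
      · exact ContinuousMap.norm_coe_le_norm _ _
      · exact (hN _ fun h => hs (hF s h)).trans (le_abs_self N)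
    have r1 := congrArg Complex.re e1
    have i1 := congrArg Complex.im e1
    have r2 := congrArg Complex.re e2
    have i2 := congrArg Complex.im e2
    simp at r1 i1 r2 i2
    have hdet : (a.re * b.im - a.im * b.re) * (p.re * q.im - p.im * q.re) = 1 := by
      calc _ = (a.re * p.re + b.re * p.im) * (a.im * q.re + b.im * q.im)
            - (a.im * p.re + b.im * p.im) * (a.re * q.re + b.re * q.im) := by ring
        _ = 1 := by rw [← r1, ← i2, ← i1]; ring
    have habs := congrArg abs hdet
    rw [abs_mul, abs_one] at habs
    rw [div_le_iff₀ (by positivity), ← habs]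
    gcongr
    linarith
  · refine (abs_det_le _ _).trans ?_
    gcongr
    · exact ContinuousMap.norm_coe_le_norm _ _
    · exact hM s hs

end Cr

/-- Characterisation of bi-orthogonality preserving real-linear surjections
`T : C_r(L₁) → C_r(L₂)`: they are exactly the maps of the form
`(Tf)(s) = a₁(s)·Re f(φ(s)) + a₂(s)·Im f(φ(s))` where `φ : L₂ → L₁` is a homeomorphism
mapping `O₂ = L₂ \ F₂` onto `O₁ = L₁ \ F₁`, `a₁ ∈ C_r(L₂)` is nowhere vanishing, `a₂` is
continuous on `O₂`, and the determinant `γ₁η₂ − γ₂η₁` (with `a₁ = γ₁ + iγ₂`,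
`a₂ = η₁ + iη₂`) is bounded and bounded away from `0` in modulus on `O₂`. -/
theorem stmt_8 {L₁ L₂ : Type*}
    [TopologicalSpace L₁] [CompactSpace L₁] [T2Space L₁]
    [TopologicalSpace L₂] [CompactSpace L₂] [T2Space L₂]
    (F₁ : Set L₁) (F₂ : Set L₂) (hF₁ : IsClosed F₁) (hF₂ : IsClosed F₂)
    (T : Cr L₁ F₁ → Cr L₂ F₂) :
    ((∀ f g : Cr L₁ F₁, T (f + g) = T f + T g) ∧
      (∀ (c : ℝ) (f : Cr L₁ F₁), T (c • f) = c • T f) ∧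
      Function.Surjective T ∧
      (∀ f g : Cr L₁ F₁, f * g = 0 ↔ T f * T g = 0)) ↔
    (∃ (φ : L₂ ≃ₜ L₁) (a₁ : Cr L₂ F₂) (a₂ : L₂ → ℂ),
      ⇑φ '' F₂ᶜ = F₁ᶜ ∧
      (∀ s : L₂, a₁.val s ≠ 0) ∧
      ContinuousOn a₂ F₂ᶜ ∧
      (∃ m M : ℝ, 0 < m ∧ ∀ s ∈ F₂ᶜ,
        m ≤ |(a₁.val s).re * (a₂ s).im - (a₁.val s).im * (a₂ s).re| ∧
        |(a₁.val s).re * (a₂ s).im - (a₁.val s).im * (a₂ s).re| ≤ M) ∧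
      (∀ (s : L₂) (f : Cr L₁ F₁),
        (T f).val s = a₁.val s * (((f.val (φ s)).re : ℝ) : ℂ)
          + a₂ s * (((f.val (φ s)).im : ℝ) : ℂ))) := by
  have himage : ∀ φ : L₂ ≃ₜ L₁, φ '' F₂ᶜ = F₁ᶜ ↔ ∀ s, φ s ∈ F₁ ↔ s ∈ F₂ := by
    intro φ
    rw [Set.image_compl_eq φ.bijective, compl_inj_iff, φ.image_eq_preimage_symm, Set.ext_iff,
      φ.symm.forall_congr_left]
    simp [iff_comm]
  constructor
  · rintro ⟨hadd, hsmul, hsurj, hmul⟩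
    let T₀ : Cr L₁ F₁ →ₗ[ℝ] Cr L₂ F₂ := ⟨⟨T, hadd⟩, hsmul⟩
    have hinj : Function.Injective T₀ := by
      rw [injective_iff_map_eq_zero]
      intro f hf
      have hff : f * f = 0 := (hmul f f).2 (by rw [show T f = 0 from hf, mul_zero])
      apply Subtype.ext
      ext t
      exact or_self_iff.1 ((Cr.mul_eq_zero_iff f f).1 hff t)
    obtain ⟨φ, a₁, a₂, hφ, h⟩ := Cr.exists_repr_of_mul_eq_zero_iff hF₁ hF₂
      (LinearEquiv.ofBijective T₀ ⟨hinj, hsurj⟩) hmul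
    exact ⟨φ, a₁, a₂, (himage φ).2 hφ, h⟩
  · rintro ⟨φ, a₁, a₂, hφ, ha₁, ha₂, ⟨m, M, hm, hdet⟩, hT⟩
    rw [himage] at hφ
    refine ⟨fun f g => ?_, fun c f => ?_, ?_, ?_⟩
    · apply Subtype.ext
      ext s
      change (T (f + g)).val s = (T f).val s + (T g).val s
      simp only [hT]
      change a₁.val s * ((f.val (φ s) + g.val (φ s)).re : ℂ)
        + a₂ s * ((f.val (φ s) + g.val (φ s)).im : ℂ) = _
      simp only [Complex.add_re, Complex.add_im, Complex.ofReal_add]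
      ring
    · apply Subtype.ext
      ext s
      change (T (c • f)).val s = c • (T f).val s
      simp only [hT]
      change a₁.val s * ((c • f.val (φ s)).re : ℂ) + a₂ s * ((c • f.val (φ s)).im : ℂ) = _
      simp only [Complex.smul_re, Complex.smul_im, smul_eq_mul, Complex.ofReal_mul]
      rw [Complex.real_smul]
      ring
    · exact Cr.surjective_of_repr hF₁ hF₂ T φ hφ a₁ a₂ ha₁ ha₂ hm (fun s hs => (hdet s hs).1) hT
    · exact Cr.mul_eq_zero_iff_of_repr T φ hφ a₁ a₂ ha₁
        (fun s hs => abs_pos.1 (hm.trans_le (hdet s hs).1)) hT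
end
end

section
/- Let V : A × A → ℝ be a bounded orthogonal real-bilinear form on A = C(K)^τ, and let Ṽ : C(K,ℂ) × C(K,ℂ) → ℂ be the complex-bilinear extension of V, i.e., the unique complex-bilinear map with Ṽ(a + ib, c + id) = V(a,c) − V(b,d) + i·(V(a,d) + V(b,c)) for all a, b, c, d ∈ A. Then Ṽ is orthogonal (meaning Ṽ(x, conj y) = 0 whenever x·(conj y) = 0 in C(K,ℂ)) if and only if there exists a bounded real-linear functional φ₁ on A such that V(x, y) = φ₁(x·y) for all x, y ∈ A. -/
noncomputable section
set_option synthInstance.maxHeartbeats 1000000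
set_option maxHeartbeats 1000000

open ComplexConjugate

/-- The real function algebra `A = C(K)^τ`, where `τ(f)(t) = conj (f (σ t))` for a period-2
homeomorphism `σ : K → K`, as a real subalgebra of `C(K, ℂ)`. -/
def Atau (K : Type*) [TopologicalSpace K] (σ : K → K) : Subalgebra ℝ C(K, ℂ) where
  carrier := {f : C(K, ℂ) | ∀ t : K, f t = conj (f (σ t))}
  mul_mem' := by
    intro f g hf hg t
    rw [ContinuousMap.mul_apply, ContinuousMap.mul_apply, map_mul, ← hf t, ← hg t]
  one_mem' := by intro t; simp
  add_mem' := by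
    intro f g hf hg t
    rw [ContinuousMap.add_apply, ContinuousMap.add_apply, map_add, ← hf t, ← hg t]
  zero_mem' := by intro t; simp
  algebraMap_mem' := by
    intro r t
    simp [Complex.conj_ofReal]

/-- The truncation of a real number to the unit interval. -/
def unitClamp (t : ℝ) : ℝ := max 0 (min 1 t)

lemma continuous_unitClamp : Continuous unitClamp := by
  unfold unitClamp; fun_prop

lemma unitClamp_nonneg (t : ℝ) : 0 ≤ unitClamp t := le_max_left _ _

lemma unitClamp_le_one (t : ℝ) : unitClamp t ≤ 1 :=
  max_le zero_le_one (min_le_left _ _)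

lemma unitClamp_mono : Monotone unitClamp := fun _ _ h =>
  max_le_max le_rfl (min_le_min le_rfl h)

lemma unitClamp_of_nonpos {t : ℝ} (h : t ≤ 0) : unitClamp t = 0 :=
  max_eq_left ((min_le_right _ _).trans h)

lemma unitClamp_of_one_le {t : ℝ} (h : 1 ≤ t) : unitClamp t = 1 := by
  simp [unitClamp, min_eq_left h]

/-- The hat function supported in `[-1, 1]` with value `1` at `0`. -/
def hat (t : ℝ) : ℝ := unitClamp (t + 1) - unitClamp t

/-- The plateau function supported in `[-2, 2]` with value `1` on `[-1, 1]`. -/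
def plateau (t : ℝ) : ℝ := unitClamp (t + 2) - unitClamp (t - 1)

lemma continuous_hat : Continuous hat := by
  have := continuous_unitClamp
  unfold hat; fun_prop

lemma continuous_plateau : Continuous plateau := by
  have := continuous_unitClamp
  unfold plateau; fun_prop

lemma hat_nonneg (t : ℝ) : 0 ≤ hat t :=
  sub_nonneg.2 (unitClamp_mono (by linarith))

lemma hat_eq_zero {t : ℝ} (h : 1 ≤ |t|) : hat t = 0 := by
  unfold hat
  rcases le_abs'.1 h with h | h
  · rw [unitClamp_of_nonpos (by linarith), unitClamp_of_nonpos (by linarith), sub_zero]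
  · rw [unitClamp_of_one_le (by linarith), unitClamp_of_one_le (by linarith), sub_self]

lemma plateau_eq_hat_add (t : ℝ) : plateau t = hat (t + 1) + hat t + hat (t - 1) := by
  unfold plateau hat
  rw [sub_add_cancel, show t + 1 + 1 = t + 2 by ring]
  ring

lemma plateau_nonneg (t : ℝ) : 0 ≤ plateau t :=
  sub_nonneg.2 (unitClamp_mono (by linarith))

lemma plateau_eq_zero {t : ℝ} (h : 2 ≤ |t|) : plateau t = 0 := by
  unfold plateau
  rcases le_abs'.1 h with h | h
  · rw [unitClamp_of_nonpos (by linarith), unitClamp_of_nonpos (by linarith), sub_zero]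
  · rw [unitClamp_of_one_le (by linarith), unitClamp_of_one_le (by linarith), sub_self]

lemma plateau_eq_one {t : ℝ} (h : |t| ≤ 1) : plateau t = 1 := by
  unfold plateau
  have := abs_le.1 h
  rw [unitClamp_of_one_le (by linarith), unitClamp_of_nonpos (by linarith), sub_zero]

lemma hat_mul_one_sub_plateau (t : ℝ) : hat t * (1 - plateau t) = 0 := by
  rcases le_total 1 |t| with h | h
  · rw [hat_eq_zero h, zero_mul]
  · rw [plateau_eq_one h, sub_self, mul_zero]

lemma sum_range_hat (t : ℝ) (N : ℕ) :
    ∑ i ∈ Finset.range N, hat (t - i) = unitClamp (t + 1) - unitClamp (t - N + 1) := by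
  induction N with
  | zero => simp
  | succ n ih =>
    rw [Finset.sum_range_succ, ih, hat]
    push_cast
    rw [show t - (n + 1 : ℝ) + 1 = t - n by ring]
    ring

lemma sum_range_hat_eq_one {t : ℝ} {N : ℕ} (h0 : 0 ≤ t) (hN : t + 1 ≤ N) :
    ∑ i ∈ Finset.range N, hat (t - i) = 1 := by
  rw [sum_range_hat, unitClamp_of_one_le (by linarith), unitClamp_of_nonpos (by linarith),
    sub_zero]

lemma sum_hat_le_one (t : ℝ) {N : ℕ} {S : Finset ℕ} (hS : S ⊆ Finset.range N) :
    ∑ i ∈ S, hat (t - i) ≤ 1 := by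
  refine (Finset.sum_le_sum_of_subset_of_nonneg hS fun i _ _ => hat_nonneg _).trans ?_
  rw [sum_range_hat]
  linarith [unitClamp_le_one (t + 1), unitClamp_nonneg (t - N + 1)]

lemma sum_plateau_le_three (t : ℝ) {N : ℕ} {S : Finset ℕ} (hS : S ⊆ Finset.range N) :
    ∑ i ∈ S, plateau (t - i) ≤ 3 := by
  have h1 := sum_hat_le_one (t + 1) hS
  have h2 := sum_hat_le_one t hS
  have h3 := sum_hat_le_one (t - 1) hS
  simp only [plateau_eq_hat_add, Finset.sum_add_distrib, sub_add_eq_add_sub, sub_right_comm t _ 1]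
  linarith

lemma abs_mul_hat_le (t : ℝ) : |t * hat t| ≤ hat t := by
  rw [abs_mul, abs_of_nonneg (hat_nonneg t)]
  rcases le_total 1 |t| with h | h
  · simp [hat_eq_zero h]
  · exact mul_le_of_le_one_left (hat_nonneg t) h

lemma abs_mul_plateau_le (t : ℝ) : |t * plateau t| ≤ 2 * plateau t := by
  rw [abs_mul, abs_of_nonneg (plateau_nonneg t)]
  rcases le_total 2 |t| with h | h
  · simp [plateau_eq_zero h]
  · exact mul_le_mul_of_nonneg_right h (plateau_nonneg t)

lemma hat_mul_plateau_eq_zero (t : ℝ) {i j : ℕ} (hij : i ≠ j) (hmod : i % 3 = j % 3) :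
    hat (t - i) * plateau (t - j) = 0 := by
  by_cases h1 : 1 ≤ |t - i|
  · rw [hat_eq_zero h1, zero_mul]
  by_cases h2 : 2 ≤ |t - j|
  · rw [plateau_eq_zero h2, mul_zero]
  exfalso
  rw [not_le, abs_lt] at h1 h2
  have h3 : i + 3 ≤ j ∨ j + 3 ≤ i := by omega
  rcases h3 with h3 | h3
  · have : (i : ℝ) + 3 ≤ j := by exact_mod_cast h3
    linarith
  · have : (j : ℝ) + 3 ≤ i := by exact_mod_cast h3
    linarith

section OrthogonalForms

variable {K : Type*} [TopologicalSpace K]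

/-- The inclusion of real-valued into complex-valued continuous functions. -/
def complexify (K : Type*) [TopologicalSpace K] : C(K, ℝ) →ₐ[ℝ] C(K, ℂ) :=
  AlgHom.compLeftContinuous ℝ Complex.ofRealAm Complex.continuous_ofReal

@[simp] lemma complexify_apply (h : C(K, ℝ)) (t : K) : complexify K h t = (h t : ℂ) := rfl

lemma norm_complexify_mul_le [CompactSpace K] {h : C(K, ℝ)} {M : ℝ} (hM : ∀ t, |h t| ≤ M)
    (hM0 : 0 ≤ M) (x : C(K, ℂ)) : ‖complexify K h * x‖ ≤ M * ‖x‖ := by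
  refine (norm_mul_le _ _).trans (mul_le_mul_of_nonneg_right ?_ (norm_nonneg _))
  refine (ContinuousMap.norm_le _ hM0).2 fun t => ?_
  simpa using hM t

lemma sum_apply_of_orthogonal {R ι : Type*} [CommRing R] [Algebra ℂ R]
    {W : R →ₗ[ℂ] R →ₗ[ℂ] ℂ} (hW : ∀ x y, x * y = 0 → W x y = 0) (S : Finset ι) (f g : ι → R)
    (hfg : ∀ i ∈ S, ∀ j ∈ S, i ≠ j → f i * g j = 0) :
    ∑ i ∈ S, W (f i) (g i) = W (∑ i ∈ S, f i) (∑ i ∈ S, g i) := by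
  rw [map_sum W, LinearMap.sum_apply]
  refine Finset.sum_congr rfl fun i hi => ?_
  rw [map_sum]
  exact (Finset.sum_eq_single_of_mem i hi fun j hj hji => hW _ _ (hfg i hi j hj hji.symm)).symm

/-- The commutator of an orthogonal form with multiplication by a nonnegative real function is
bounded independently of that function. -/
lemma norm_commutator_le [CompactSpace K] {W : C(K, ℂ) →ₗ[ℂ] C(K, ℂ) →ₗ[ℂ] ℂ} {C : ℝ}
    (hC : ∀ x y, ‖W x y‖ ≤ C * ‖x‖ * ‖y‖) (hC0 : 0 ≤ C)
    (hW : ∀ x y, x * y = 0 → W x y = 0) (h : C(K, ℝ)) (h0 : ∀ t, 0 ≤ h t) (x y : C(K, ℂ)) :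
    ‖W (complexify K h * x) y - W x (complexify K h * y)‖ ≤ 27 * (C * ‖x‖ * ‖y‖) := by
  obtain ⟨N, hN⟩ := exists_nat_ge (‖h‖ + 1)
  set ρ := complexify K
  let p : ℕ → C(K, ℝ) := fun i =>
    ⟨fun t => hat (h t - i), continuous_hat.comp (by fun_prop)⟩
  let q : ℕ → C(K, ℝ) := fun i =>
    ⟨fun t => plateau (h t - i), continuous_plateau.comp (by fun_prop)⟩
  have hsum : ∑ i ∈ Finset.range N, p i = 1 := by
    ext t
    rw [ContinuousMap.sum_apply]
    refine sum_range_hat_eq_one (h0 t) ?_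
    linarith [le_abs_self (h t), h.norm_coe_le_norm t, Real.norm_eq_abs (h t)]
  have hpq (i : ℕ) : p i * (1 - q i) = 0 := by
    ext t; exact hat_mul_one_sub_plateau _
  have hpq' {i j : ℕ} (hij : i ≠ j) (hmod : i % 3 = j % 3) : p i * q j = 0 := by
    ext t; exact hat_mul_plateau_eq_zero _ hij hmod
  have hloc (i : ℕ) (u v : C(K, ℂ)) : W (ρ (p i) * u) v = W (ρ (p i) * u) (ρ (q i) * v) := by
    rw [← sub_eq_zero, ← map_sub]
    apply hW
    have := congrArg ρ (hpq i)
    rw [map_mul, map_sub, map_one, map_zero] at this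
    linear_combination (u * v) * this
  have hexp (u v : C(K, ℂ)) :
      W u v = ∑ i ∈ Finset.range N, W (ρ (p i) * u) (ρ (q i) * v) := by
    have hu : u = ∑ i ∈ Finset.range N, ρ (p i) * u := by
      rw [← Finset.sum_mul, ← map_sum, hsum, map_one, one_mul]
    conv_lhs => rw [hu, map_sum W, LinearMap.sum_apply]
    exact Finset.sum_congr rfl fun i _ => hloc i u v
  let D : ℕ → ℂ := fun i => W (ρ ((h - (i : C(K, ℝ))) * p i) * x) (ρ (q i) * y) -
    W (ρ (p i) * x) (ρ ((h - (i : C(K, ℝ))) * q i) * y)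
  have hD : W (ρ h * x) y - W x (ρ h * y) = ∑ i ∈ Finset.range N, D i := by
    rw [hexp (ρ h * x), hexp x, ← Finset.sum_sub_distrib]
    refine Finset.sum_congr rfl fun i _ => ?_
    have hi : ρ (i : C(K, ℝ)) = (i : C(K, ℂ)) := map_natCast ρ i
    simp only [D, map_mul ρ, map_sub ρ, hi, sub_mul, mul_assoc]
    simp only [← nsmul_eq_mul, map_sub, map_nsmul, LinearMap.sub_apply, LinearMap.smul_apply]
    rw [mul_left_comm (ρ h) (ρ (p i)), mul_left_comm (ρ h) (ρ (q i))]
    ring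
  have hclass (r : ℕ) :
      ‖∑ i ∈ Finset.range N with i % 3 = r, D i‖ ≤ 9 * (C * ‖x‖ * ‖y‖) := by
    set S := (Finset.range N).filter (fun i => i % 3 = r)
    have hS : S ⊆ Finset.range N := Finset.filter_subset _ _
    have hmod {i j : ℕ} (hi : i ∈ S) (hj : j ∈ S) : i % 3 = j % 3 := by
      rw [(Finset.mem_filter.1 hi).2, (Finset.mem_filter.1 hj).2]
    have hP (t : K) : |(∑ i ∈ S, p i) t| ≤ 1 := by
      rw [ContinuousMap.sum_apply]
      change |∑ i ∈ S, hat (h t - i)| ≤ 1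
      rw [abs_of_nonneg (Finset.sum_nonneg fun i _ => hat_nonneg _)]
      exact sum_hat_le_one (h t) hS
    have hQ (t : K) : |(∑ i ∈ S, q i) t| ≤ 3 := by
      rw [ContinuousMap.sum_apply]
      change |∑ i ∈ S, plateau (h t - i)| ≤ 3
      rw [abs_of_nonneg (Finset.sum_nonneg fun i _ => plateau_nonneg _)]
      exact sum_plateau_le_three (h t) hS
    have hP' (t : K) : |(∑ i ∈ S, (h - (i : C(K, ℝ))) * p i) t| ≤ 1 := by
      rw [ContinuousMap.sum_apply]
      change |∑ i ∈ S, (h t - i) * hat (h t - i)| ≤ 1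
      exact (Finset.abs_sum_le_sum_abs _ _).trans
        ((Finset.sum_le_sum fun i _ => abs_mul_hat_le _).trans (sum_hat_le_one (h t) hS))
    have hQ' (t : K) : |(∑ i ∈ S, (h - (i : C(K, ℝ))) * q i) t| ≤ 6 := by
      rw [ContinuousMap.sum_apply]
      change |∑ i ∈ S, (h t - i) * plateau (h t - i)| ≤ 6
      refine (Finset.abs_sum_le_sum_abs _ _).trans
        ((Finset.sum_le_sum fun i _ => abs_mul_plateau_le _).trans ?_)
      rw [← Finset.mul_sum]
      linarith [sum_plateau_le_three (h t) hS]
    have horth {i j : ℕ} (hi : i ∈ S) (hj : j ∈ S) (hij : i ≠ j) : ρ (p i) * ρ (q j) = 0 := by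
      rw [← map_mul, hpq' hij (hmod hi hj), map_zero]
    have hsumD : ∑ i ∈ S, D i =
        W (ρ (∑ i ∈ S, (h - (i : C(K, ℝ))) * p i) * x) (ρ (∑ i ∈ S, q i) * y) -
        W (ρ (∑ i ∈ S, p i) * x) (ρ (∑ i ∈ S, (h - (i : C(K, ℝ))) * q i) * y) := by
      simp only [D]
      rw [Finset.sum_sub_distrib, sum_apply_of_orthogonal hW, sum_apply_of_orthogonal hW]
      · simp only [map_sum, Finset.sum_mul]
      · intro i hi j hj hij
        rw [map_mul ρ (h - _)]
        linear_combination (x * y * ρ (h - (j : C(K, ℝ)))) * horth hi hj hij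
      · intro i hi j hj hij
        rw [map_mul ρ (h - _)]
        linear_combination (x * y * ρ (h - (i : C(K, ℝ)))) * horth hi hj hij
    have hbound {a b : C(K, ℝ)} {k l : ℝ} (ha : ∀ t, |a t| ≤ k) (hb : ∀ t, |b t| ≤ l)
        (hk : 0 ≤ k) (hl : 0 ≤ l) :
        ‖W (ρ a * x) (ρ b * y)‖ ≤ k * l * (C * ‖x‖ * ‖y‖) :=
      calc ‖W (ρ a * x) (ρ b * y)‖ ≤ C * ‖ρ a * x‖ * ‖ρ b * y‖ := hC _ _
        _ ≤ C * (k * ‖x‖) * (l * ‖y‖) := by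
          gcongr
          · exact norm_complexify_mul_le ha hk x
          · exact norm_complexify_mul_le hb hl y
        _ = _ := by ring
    rw [hsumD]
    refine (norm_sub_le _ _).trans ((add_le_add (hbound hP' hQ zero_le_one (by norm_num))
      (hbound hP hQ' zero_le_one (by norm_num))).trans (le_of_eq (by ring)))
  have hsplit : ∑ i ∈ Finset.range N, D i =
      ∑ r ∈ Finset.range 3, ∑ i ∈ Finset.range N with i % 3 = r, D i :=
    (Finset.sum_fiberwise_of_maps_to
      (fun i _ => Finset.mem_range.2 (Nat.mod_lt i (by norm_num))) _).symm
  rw [hD, hsplit]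
  refine (norm_sum_le_of_le _ fun r _ => hclass r).trans (le_of_eq ?_)
  rw [Finset.sum_const, Finset.card_range, nsmul_eq_mul]
  ring

/-- A bounded orthogonal form is balanced over `C(K, ℂ)`. -/
lemma apply_mul_comm_of_orthogonal [CompactSpace K] {W : C(K, ℂ) →ₗ[ℂ] C(K, ℂ) →ₗ[ℂ] ℂ} {C : ℝ}
    (hC : ∀ x y, ‖W x y‖ ≤ C * ‖x‖ * ‖y‖) (hC0 : 0 ≤ C)
    (hW : ∀ x y, x * y = 0 → W x y = 0) (z x y : C(K, ℂ)) : W (z * x) y = W x (z * y) := by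
  have hnonneg (h : C(K, ℝ)) (h0 : ∀ t, 0 ≤ h t) :
      W (complexify K h * x) y = W x (complexify K h * y) := by
    rw [← sub_eq_zero, ← norm_eq_zero]
    set d := W (complexify K h * x) y - W x (complexify K h * y) with hd
    by_contra hne
    have hpos : 0 < ‖d‖ := lt_of_le_of_ne (norm_nonneg _) (Ne.symm hne)
    obtain ⟨n, hn⟩ := exists_nat_gt (27 * (C * ‖x‖ * ‖y‖) / ‖d‖)
    have key := norm_commutator_le hC hC0 hW (n • h)
      (fun t => by simpa using mul_nonneg n.cast_nonneg (h0 t)) x y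
    rw [map_nsmul, smul_mul_assoc, smul_mul_assoc, map_nsmul, map_nsmul, LinearMap.smul_apply,
      ← smul_sub, ← hd, nsmul_eq_mul, norm_mul, Complex.norm_natCast] at key
    rw [div_lt_iff₀ hpos] at hn
    linarith
  have hreal (h : C(K, ℝ)) : W (complexify K h * x) y = W x (complexify K h * y) := by
    have h1 := hnonneg (h + ‖h‖ • 1) fun t => by
      have := neg_abs_le (h t)
      have := h.norm_coe_le_norm t
      rw [Real.norm_eq_abs] at this
      simp
      linarith
    have h2 := hnonneg (‖h‖ • 1) fun t => by simp
    rw [map_add, add_mul, add_mul, map_add, map_add, LinearMap.add_apply, h2] at h1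
    exact add_right_cancel h1
  let u : C(K, ℝ) := ⟨fun t => (z t).re, by fun_prop⟩
  let v : C(K, ℝ) := ⟨fun t => (z t).im, by fun_prop⟩
  have hz : z = complexify K u + Complex.I • complexify K v := by
    ext t
    simp [u, v, mul_comm Complex.I, Complex.re_add_im]
  rw [hz]
  simp only [add_mul, smul_mul_assoc, map_add, map_smul, LinearMap.add_apply,
    LinearMap.smul_apply, hreal]

end OrthogonalForms

section RealForm

variable {K : Type*} [TopologicalSpace K] {σ : K → K}

/-- Every continuous function is `a + ib` with `a, b` in the real form, and `a`, `b` are bounded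
by the norm of the function. -/
lemma exists_eq_add_I_smul [CompactSpace K] (hσc : Continuous σ) (hσ2 : σ ∘ σ = id)
    (x : C(K, ℂ)) : ∃ a b : Atau K σ,
      x = a.val + Complex.I • b.val ∧ ‖a.val‖ ≤ ‖x‖ ∧ ‖b.val‖ ≤ ‖x‖ := by
  have hσ (t : K) : σ (σ t) = t := congrFun hσ2 t
  have hI : Complex.I * Complex.I = -1 := Complex.I_mul_I
  have hn (t : K) (c : ℂ) (hc : ‖c‖ = 1) :
      ‖c * (x t + conj (x (σ t))) / 2‖ ≤ ‖x‖ ∧ ‖c * (x t - conj (x (σ t))) / 2‖ ≤ ‖x‖ := by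
    have h1 := x.norm_coe_le_norm t
    have h2 := x.norm_coe_le_norm (σ t)
    have h3 := norm_add_le (x t) (conj (x (σ t)))
    have h4 := norm_sub_le (x t) (conj (x (σ t)))
    rw [RCLike.norm_conj] at h3 h4
    rw [norm_div, norm_div, norm_mul, norm_mul, hc, Complex.norm_two]
    constructor <;> linarith
  have hconj : Continuous (fun t => conj (x (σ t))) :=
    Complex.continuous_conj.comp (x.continuous.comp hσc)
  refine ⟨⟨⟨fun t => 1 * (x t + conj (x (σ t))) / 2, by fun_prop⟩, fun t => ?_⟩,
    ⟨⟨fun t => -Complex.I * (x t - conj (x (σ t))) / 2, by fun_prop⟩, fun t => ?_⟩, ?_, ?_, ?_⟩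
  · simp [hσ, add_comm, Complex.conj_ofNat]
  · simp [hσ, Complex.conj_ofNat]
    ring
  · ext t
    simp
    linear_combination (x t - conj (x (σ t))) / 2 * hI
  · exact (ContinuousMap.norm_le _ (norm_nonneg _)).2 fun t => (hn t 1 (by simp)).1
  · exact (ContinuousMap.norm_le _ (norm_nonneg _)).2 fun t => (hn t (-Complex.I) (by simp)).2

/-- The sum `A + iA` is direct. -/
lemma eq_zero_of_add_I_smul_eq_zero {a b : Atau K σ}
    (h : a.val + Complex.I • b.val = 0) : a = 0 ∧ b = 0 := by
  have hI : Complex.I * Complex.I = -1 := Complex.I_mul_I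
  have h1 (t : K) : a.val t + Complex.I * b.val t = 0 := by
    simpa using DFunLike.congr_fun h t
  have h2 (t : K) : a.val t - Complex.I * b.val t = 0 := by
    have := congrArg conj (h1 (σ t))
    rw [map_add, map_mul, ← a.2 t, ← b.2 t, Complex.conj_I, map_zero] at this
    linear_combination this
  constructor <;> ext t
  · change a.val t = 0
    linear_combination (h1 t + h2 t) / 2
  · change b.val t = 0
    linear_combination -Complex.I * (h1 t - h2 t) / 2 + b.val t * hI

end RealForm

/-- Let `V` be a bounded orthogonal real-bilinear form on `A = C(K)^τ`, and
let `W` be its complex-bilinear extension to `C(K, ℂ) = A ⊕ iA`.  Then `W` is orthogonal if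
and only if `V x y = φ₁ (x y)` for some bounded real-linear functional `φ₁` on `A`. -/
theorem stmt_11 {K : Type*} [TopologicalSpace K] [CompactSpace K] [T2Space K]
    (σ : K → K) (hσc : Continuous σ) (hσ2 : σ ∘ σ = id)
    (V : Atau K σ →ₗ[ℝ] Atau K σ →ₗ[ℝ] ℝ)
    (hVbdd : ∃ C : ℝ, ∀ x y : Atau K σ, |V x y| ≤ C * ‖x.val‖ * ‖y.val‖)
    (hVorth : ∀ f g : Atau K σ, f.val * g.val = 0 → V f g = 0)
    (W : C(K, ℂ) →ₗ[ℂ] C(K, ℂ) →ₗ[ℂ] ℂ)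
    (hW : ∀ a b c d : Atau K σ,
      W (a.val + Complex.I • b.val) (c.val + Complex.I • d.val)
        = (((V a c - V b d : ℝ)) : ℂ) + Complex.I * (((V a d + V b c : ℝ)) : ℂ)) :
    (∀ x y : C(K, ℂ), x * star y = 0 → W x (star y) = 0) ↔
      ∃ φ₁ : Atau K σ →ₗ[ℝ] ℝ, (∃ C : ℝ, ∀ x : Atau K σ, |φ₁ x| ≤ C * ‖x.val‖) ∧
        ∀ x y : Atau K σ, V x y = φ₁ (x * y) := by
  have hWV (x y : Atau K σ) : W x.val y.val = (V x y : ℂ) := by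
    simpa using hW x 0 y 0
  constructor
  · intro horth
    have hW0 (x y : C(K, ℂ)) (hxy : x * y = 0) : W x y = 0 := by
      simpa using horth x (star y) (by simpa using hxy)
    obtain ⟨C, hC⟩ := hVbdd
    have hV' {m n : ℝ} (a b : Atau K σ) (ha : ‖a.val‖ ≤ m) (hb : ‖b.val‖ ≤ n) :
        |V a b| ≤ |C| * m * n := by
      have hm : 0 ≤ m := (norm_nonneg _).trans ha
      calc |V a b| ≤ C * ‖a.val‖ * ‖b.val‖ := hC a b
        _ ≤ |C| * m * n := by gcongr; exact le_abs_self C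
    have hWbdd (x y : C(K, ℂ)) : ‖W x y‖ ≤ (4 * |C|) * ‖x‖ * ‖y‖ := by
      obtain ⟨a, b, hx, ha, hb⟩ := exists_eq_add_I_smul hσc hσ2 x
      obtain ⟨c, d, hy, hc, hd⟩ := exists_eq_add_I_smul hσc hσ2 y
      have hval : W x y = (((V a c - V b d : ℝ)) : ℂ) +
          Complex.I * (((V a d + V b c : ℝ)) : ℂ) := by
        rw [← hW a b c d, ← hx, ← hy]
      rw [hval]
      refine (norm_add_le _ _).trans ?_
      rw [norm_mul, Complex.norm_I, one_mul, Complex.norm_real, Complex.norm_real,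
        Real.norm_eq_abs, Real.norm_eq_abs]
      linarith [abs_sub (V a c) (V b d), abs_add_le (V a d) (V b c), hV' a c ha hc,
        hV' b d hb hd, hV' a d ha hd, hV' b c hb hc]
    refine ⟨V.flip 1, ⟨C * ‖(1 : C(K, ℂ))‖, fun x => ?_⟩, fun x y => ?_⟩
    · exact (hC x 1).trans (le_of_eq (mul_right_comm _ _ _))
    · have key := apply_mul_comm_of_orthogonal hWbdd (by positivity) hW0 y.val x.val 1
      have h1 := hWV (x * y) 1
      have h2 := hWV x y
      have : W (y.val * x.val) 1 = (V (x * y) 1 : ℂ) := by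
        rw [← h1, mul_comm]; rfl
      rw [mul_one, h2, this] at key
      exact (Complex.ofReal_injective key).symm
  · rintro ⟨φ₁, -, hφ⟩ x y hxy
    obtain ⟨a, b, hx, -, -⟩ := exists_eq_add_I_smul hσc hσ2 x
    obtain ⟨c, d, hy, -, -⟩ := exists_eq_add_I_smul hσc hσ2 (star y)
    have hI : Complex.I * Complex.I = -1 := Complex.I_mul_I
    have hprod : (a * c - b * d).val + Complex.I • (a * d + b * c).val = 0 := by
      rw [← hxy, hx, hy]
      ext t
      simp
      linear_combination -(b.val t * d.val t) * hI
    obtain ⟨h1, h2⟩ := eq_zero_of_add_I_smul_eq_zero hprod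
    rw [hx, hy, hW, hφ, hφ, hφ, hφ, ← map_sub, ← map_add, h1, h2]
    simp
end
end

section
/- Let A be a unital commutative real C*-algebra and let φ₁, φ₂, ψ₁, ψ₂ be bounded real-linear functionals on A. Then φ₁(x·y) + φ₂(x·y*) = ψ₁(x·y) + ψ₂(x·y*) for every x, y ∈ A if and only if all of the following hold: (i) φ₁ + φ₂ = ψ₁ + ψ₂ as functionals on A; (ii) (φ₁ − φ₂)(z) = (ψ₁ − ψ₂)(z) for every skew-symmetric z ∈ A (i.e., z* = −z); and (iii) (φ₁ − φ₂)(z·w) = (ψ₁ − ψ₂)(z·w) for all skew-symmetric z, w ∈ A. -/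
/-- In a unital commutative real C*-algebra `A`, two pairs of bounded
real-linear functionals `(φ₁, φ₂)` and `(ψ₁, ψ₂)` represent the same form
`(x,y) ↦ φ₁(xy) + φ₂(xy*)` if and only if `φ₁ + φ₂ = ψ₁ + ψ₂`, and `φ₁ − φ₂` agrees with
`ψ₁ − ψ₂` on all skew-symmetric elements and on all products of two skew-symmetric
elements. -/
theorem stmt_12 {A : Type*} [NormedCommRing A] [StarRing A] [CStarRing A] [NormedAlgebra ℝ A]
    [CompleteSpace A] [StarModule ℝ A]
    (hA : ∀ a : A, IsUnit (1 + star a * a))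
    (φ₁ φ₂ ψ₁ ψ₂ : A →L[ℝ] ℝ) :
    (∀ x y : A, φ₁ (x * y) + φ₂ (x * star y) = ψ₁ (x * y) + ψ₂ (x * star y)) ↔
      ((∀ x : A, φ₁ x + φ₂ x = ψ₁ x + ψ₂ x) ∧
        (∀ z : A, star z = -z → φ₁ z - φ₂ z = ψ₁ z - ψ₂ z) ∧
        (∀ z w : A, star z = -z → star w = -w →
          φ₁ (z * w) - φ₂ (z * w) = ψ₁ (z * w) - ψ₂ (z * w))) := by
  constructor
  · intro h
    refine ⟨fun x => ?_, fun z hz => ?_, fun z w _ hw => ?_⟩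
    · simpa using h x 1
    · simpa [hz, sub_eq_add_neg] using h 1 z
    · simpa [hw, sub_eq_add_neg] using h z w
  · rintro ⟨hadd, hskew, hmul⟩ x y
    have hw : star (y - star y) = -(y - star y) := by simp
    have hsub : star (x - star x) = -(x - star x) := by simp
    have hsymm : star ((x + star x) * (y - star y)) = -((x + star x) * (y - star y)) := by
      rw [star_mul, hw, star_add, star_star]
      ring
    have h₁ := hskew _ hsymm
    have h₂ := hmul _ _ hsub hw
    have h₃ := hadd (x * y)
    have h₄ := hadd (x * star y)
    have h₅ := hadd (star x * y)
    have h₆ := hadd (star x * star y)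
    simp only [add_mul, sub_mul, mul_sub, map_add, map_sub] at h₁ h₂
    linarith
end

section
/- Let X be a complex Banach space and let τ : X → X be a conjugate-linear isometry with τ ∘ τ = id (i.e., τ is additive, τ(c·x) = conj(c)·τ(x) for all c ∈ ℂ, x ∈ X, and ‖τ(x)‖ = ‖x‖). If X, regarded as a real Banach space, has Pełczyński's property (V), then the closed real-linear subspace X^τ = {x ∈ X : τ(x) = x} also has Pełczyński's property (V). -/
noncomputable section

open ComplexConjugate

/-- A series `∑ xₙ` in a (real) normed group is weakly unconditionally Cauchy if there is
`C > 0` bounding the norms of all finite signed partial sums. -/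
def IsWUC {Z : Type*} [NormedAddCommGroup Z] (x : ℕ → Z) : Prop :=
  ∃ C : ℝ, 0 < C ∧ ∀ (s : Finset ℕ) (ε : ℕ → ℤ), (∀ n, ε n = 1 ∨ ε n = -1) →
    ‖∑ n ∈ s, ε n • x n‖ ≤ C

/-- A bounded real-linear operator is unconditionally converging if it sends w.u.C. series to
unconditionally convergent series (i.e. every subseries of the image series is norm
convergent). -/
def UnconditionallyConverging {Z Y : Type*} [NormedAddCommGroup Z] [NormedSpace ℝ Z]
    [NormedAddCommGroup Y] [NormedSpace ℝ Y] (T : Z →L[ℝ] Y) : Prop :=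
  ∀ x : ℕ → Z, IsWUC x → ∀ S : Set ℕ,
    ∃ y : Y, Filter.Tendsto
      (fun N => ∑ n ∈ Finset.range N, S.indicator (fun n => T (x n)) n)
      Filter.atTop (nhds y)

/-- A bounded real-linear operator is weakly compact if the image of the closed unit ball is
relatively compact in the weak topology of the codomain. -/
def IsWeaklyCompactOp {Z Y : Type*} [NormedAddCommGroup Z] [NormedSpace ℝ Z]
    [NormedAddCommGroup Y] [NormedSpace ℝ Y] (T : Z →L[ℝ] Y) : Prop :=
  IsCompact (closure ((toWeakSpace ℝ Y) '' (T '' Metric.closedBall 0 1)))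

/-- Pełczyński's property (V): every unconditionally converging operator into any (real) Banach
space is weakly compact. -/
def PropertyV (Z : Type*) [NormedAddCommGroup Z] [NormedSpace ℝ Z] : Prop :=
  ∀ (Y : Type) (_ : NormedAddCommGroup Y) (_ : NormedSpace ℝ Y) (_ : CompleteSpace Y)
    (T : Z →L[ℝ] Y), UnconditionallyConverging T → IsWeaklyCompactOp T

/-- A contractive additive map sends w.u.C. series to w.u.C. series. -/
theorem IsWUC.map {Z W F : Type*} [NormedAddCommGroup Z] [NormedAddCommGroup W]
    [FunLike F Z W] [AddMonoidHomClass F Z W] {x : ℕ → Z} (hx : IsWUC x) (f : F)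
    (hf : ∀ z, ‖f z‖ ≤ ‖z‖) : IsWUC (fun n => f (x n)) := by
  obtain ⟨C, hC, h⟩ := hx
  refine ⟨C, hC, fun s ε hε => ?_⟩
  have hsum : ∑ n ∈ s, ε n • f (x n) = f (∑ n ∈ s, ε n • x n) := by
    simp only [map_sum, map_zsmul]
  rw [hsum]
  exact (hf _).trans (h s ε hε)

/-- Property (V) passes to isometric copies of contractively complemented subspaces. -/
theorem PropertyV.of_contractive_retraction {Z W : Type*} [NormedAddCommGroup Z] [NormedSpace ℝ Z]
    [NormedAddCommGroup W] [NormedSpace ℝ W] (hZ : PropertyV Z) (P : Z →L[ℝ] W) (i : W → Z)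
    (hP : ∀ z, ‖P z‖ ≤ ‖z‖) (hi : ∀ w, ‖i w‖ ≤ ‖w‖) (hPi : ∀ w, P (i w) = w) :
    PropertyV W := by
  intro Y _ _ _ T hT
  have hTP : UnconditionallyConverging (T.comp P) := fun x hx => hT _ (hx.map P hP)
  refine (hZ Y _ _ ‹_› (T.comp P) hTP).of_isClosed_subset isClosed_closure
    (closure_mono (Set.image_mono ?_))
  rintro _ ⟨w, hw, rfl⟩
  rw [mem_closedBall_zero_iff] at hw
  exact ⟨i w, mem_closedBall_zero_iff.2 ((hi w).trans hw), by simp [hPi]⟩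

/-- If `X` is a complex Banach space with a conjugate-linear period-2 isometry
`τ`, and `X` (as a real Banach space) has Pełczyński's property (V), then the real form
`X^τ = {x : X | τ x = x}` also has property (V). -/
theorem stmt_14 {X : Type} [NormedAddCommGroup X] [NormedSpace ℂ X] [CompleteSpace X]
    (τ : X → X)
    (hadd : ∀ x y : X, τ (x + y) = τ x + τ y)
    (hsmul : ∀ (c : ℂ) (x : X), τ (c • x) = (conj c) • τ x)
    (hiso : ∀ x : X, ‖τ x‖ = ‖x‖)
    (hinv : τ ∘ τ = id)
    (hX : PropertyV X) :
    ∀ S : Submodule ℝ X, (S : Set X) = {x : X | τ x = x} → PropertyV S := by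
  intro S hS
  have hmem (x : X) : x ∈ S ↔ τ x = x := by rw [← SetLike.mem_coe, hS, Set.mem_ofPred_eq]
  have hττ (x : X) : τ (τ x) = x := congrFun hinv x
  have hreal (r : ℝ) (x : X) : τ (r • x) = r • τ x := by
    simpa using hsmul (r : ℂ) x
  let L : X →ₗ[ℝ] S :=
    { toFun := fun x => ⟨(1 / 2 : ℝ) • (x + τ x), by
        rw [hmem, hreal, hadd, hττ, add_comm]⟩
      map_add' := fun x y => by
        ext
        simp only [hadd, Submodule.coe_add]
        module
      map_smul' := fun r x => by
        ext
        simp only [hreal, Submodule.coe_smul, RingHom.id_apply]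
        module }
  have hL (x : X) : ‖L x‖ ≤ ‖x‖ := by
    change ‖(1 / 2 : ℝ) • (x + τ x)‖ ≤ ‖x‖
    rw [norm_smul, Real.norm_of_nonneg (by norm_num)]
    linarith [norm_add_le x (τ x), hiso x]
  refine hX.of_contractive_retraction (L.mkContinuous 1 fun x => by simpa using hL x)
    (fun w : S => (w : X)) hL (fun w => le_rfl) fun w => ?_
  ext
  change (1 / 2 : ℝ) • ((w : X) + τ w) = w
  rw [(hmem w).1 w.2]
  module
end
end

section
/- Let T : C_r(L₁) → C_r(L₂) be an orthogonality preserving real-linear map (not assumed bounded), and let Z₁ = {s ∈ L₂ : the real-linear functional f ↦ (Tf)(s) on C_r(L₁) is bounded and nonzero}. Then there exists M ≥ 0 such that |(Tf)(s)| ≤ M for every s ∈ Z₁ and every f ∈ C_r(L₁) satisfying |Re(f(t))| ≤ 1 and |Im(f(t))| ≤ 1 for all t ∈ L₁. -/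
noncomputable section
set_option synthInstance.maxHeartbeats 1000000
set_option maxHeartbeats 1000000

/-- `C_r(L)` is closed in `C(L, ℂ)`. -/
theorem isClosed_Cr (L : Type*) [TopologicalSpace L] (F : Set L) :
    IsClosed (Cr L F : Set C(L, ℂ)) := by
  have h : (Cr L F : Set C(L, ℂ)) = ⋂ t ∈ F, {f : C(L, ℂ) | (f t).im = 0} := by
    ext f
    simp only [Set.mem_iInter, Set.mem_ofPred_eq]
    rfl
  rw [h]
  exact isClosed_biInter fun t _ =>
    isClosed_eq (Complex.continuous_im.comp (continuous_eval_const t))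
      continuous_const

/-- If `T : C_r(L₁) → C_r(L₂)` is an orthogonality preserving real-linear
map and `Z₁` is the set of points `s` where `f ↦ (Tf)(s)` is a bounded nonzero functional,
then the values `(Tf)(s)`, for `s ∈ Z₁` and `f` with `|Re f| ≤ 1` and `|Im f| ≤ 1`
pointwise, are uniformly bounded. -/
theorem stmt_15 {L₁ L₂ : Type*}
    [TopologicalSpace L₁] [CompactSpace L₁] [T2Space L₁]
    [TopologicalSpace L₂] [CompactSpace L₂] [T2Space L₂]
    (F₁ : Set L₁) (F₂ : Set L₂) (hF₁ : IsClosed F₁) (hF₂ : IsClosed F₂)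
    (T : Cr L₁ F₁ →ₗ[ℝ] Cr L₂ F₂)
    (hT : ∀ f g : Cr L₁ F₁, f * g = 0 → T f * T g = 0)
    (Z₁ : Set L₂)
    (hZ₁ : Z₁ = {s : L₂ | (∃ C : ℝ, ∀ f : Cr L₁ F₁, ‖(T f).val s‖ ≤ C * ‖f.val‖) ∧
      ∃ f : Cr L₁ F₁, (T f).val s ≠ 0}) :
    ∃ M : ℝ, 0 ≤ M ∧ ∀ s ∈ Z₁, ∀ f : Cr L₁ F₁,
      (∀ t : L₁, |(f.val t).re| ≤ 1 ∧ |(f.val t).im| ≤ 1) → ‖(T f).val s‖ ≤ M := by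
  let _ : NormedSpace ℝ (Cr L₁ F₁) := Submodule.normedSpace (Subalgebra.toSubmodule (Cr L₁ F₁))
  have : CompleteSpace (Cr L₁ F₁) := (isClosed_Cr L₁ F₁).completeSpace_coe
  subst hZ₁
  let φ (s : L₂) : Cr L₁ F₁ →ₗ[ℝ] ℂ :=
    { toFun := fun f => (T f).val s
      map_add' := fun f g => by simp
      map_smul' := fun c f => by simp }
  let Z : Set L₂ := {s : L₂ | (∃ C : ℝ, ∀ f : Cr L₁ F₁, ‖(T f).val s‖ ≤ C * ‖f.val‖) ∧
    ∃ f : Cr L₁ F₁, (T f).val s ≠ 0}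
  let Φ (s : Z) : Cr L₁ F₁ →L[ℝ] ℂ :=
    (φ s).mkContinuousOfExistsBound s.2.1
  obtain ⟨C, hC⟩ := banach_steinhaus (g := Φ) fun f =>
    ⟨‖(T f).val‖, fun s => (T f).val.norm_coe_le_norm s⟩
  refine ⟨|C| * 2, by positivity, fun s hs f hf => ?_⟩
  have hf2 : ‖f‖ ≤ 2 := by
    refine (ContinuousMap.norm_le f.val zero_le_two).2 fun t => ?_
    linarith [Complex.norm_le_abs_re_add_abs_im (f.val t), (hf t).1, (hf t).2]
  calc ‖(T f).val s‖ = ‖Φ ⟨s, hs⟩ f‖ := rfl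
    _ ≤ ‖Φ ⟨s, hs⟩‖ * ‖f‖ := (Φ ⟨s, hs⟩).le_opNorm f
    _ ≤ |C| * 2 := by
      gcongr
      exact (hC ⟨s, hs⟩).trans (le_abs_self C)
end
end
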